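/- Let Δ ⊂ ℝⁿ be a convex lattice polytope and f : ℝⁿ → ℝ a polynomial. Then p(N,f) := Σ_{ℓ ∈ (N·Δ)∩ℤⁿ} f(ℓ) is a polynomial in the positive integer N. -/

import Mathlib

open Pointwise

namespace Ehr

/-! ### Part 1: generating functions -/

/-- The span of `(1-X)^{-j}`, `j ≥ d`. -/
noncomputable def W (d : ℕ) : Submodule ℝ (PowerSeries ℝ) :=
  Submodule.span ℝ {g | ∃ j, d ≤ j ∧ g = (PowerSeries.mk 1 : PowerSeries ℝ) ^ j}

lemma W_mul {a b : ℕ} {f g : PowerSeries ℝ} (hf : f ∈ W a) (hg : g ∈ W b) :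
    f * g ∈ W (a + b) := by
  have h : f * g ∈ W a * W b := Submodule.mul_mem_mul hf hg
  rw [W, W, Submodule.span_mul_span] at h
  refine Submodule.span_mono ?_ h
  rintro _ ⟨_, ⟨i, hi, rfl⟩, _, ⟨j, hj, rfl⟩, rfl⟩
  exact ⟨i + j, by omega, by simp [pow_add]⟩

/-- generating function of `k ↦ k^e` -/
noncomputable def P (e : ℕ) : PowerSeries ℝ := PowerSeries.mk fun k => (k : ℝ) ^ e

/-- the operator `X d/dX` -/
noncomputable def theta : PowerSeries ℝ →ₗ[ℝ] PowerSeries ℝ where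
  toFun g := PowerSeries.mk fun k => (k : ℝ) * PowerSeries.coeff k g
  map_add' f g := by ext k; simp [mul_add]
  map_smul' c g := by ext k; simp; ring

lemma theta_pow (j : ℕ) : theta ((PowerSeries.mk 1 : PowerSeries ℝ) ^ (j + 1)) =
    ((j : ℝ) + 1) • ((PowerSeries.mk 1 : PowerSeries ℝ) ^ (j + 2) -
      (PowerSeries.mk 1 : PowerSeries ℝ) ^ (j + 1)) := by
  rw [PowerSeries.mk_one_pow_eq_mk_choose_add, show j + 2 = (j + 1) + 1 from rfl,
    PowerSeries.mk_one_pow_eq_mk_choose_add]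
  ext m
  simp only [theta, LinearMap.coe_mk, AddHom.coe_mk, PowerSeries.coeff_mk, map_smul, map_sub,
    smul_eq_mul]
  have h1 : (j + 1 + m).choose (j + 1) = (j + m).choose j + (j + m).choose (j + 1) := by
    rw [show j + 1 + m = (j + m) + 1 by ring, Nat.choose_succ_succ]
  have h2 := Nat.choose_succ_right_eq (j + m) j
  rw [Nat.add_sub_cancel_left] at h2
  have h2' : (((j + m).choose (j + 1) : ℕ) : ℝ) * ((j : ℝ) + 1) = ((j + m).choose j : ℕ) * m := by
    exact_mod_cast h2
  rw [h1]
  push_cast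
  linarith

lemma theta_mem {g : PowerSeries ℝ} (hg : g ∈ W 1) : theta g ∈ W 1 := by
  induction hg using Submodule.span_induction with
  | mem x hx =>
    obtain ⟨j, hj, rfl⟩ := hx
    obtain ⟨j, rfl⟩ : ∃ i, j = i + 1 := ⟨j - 1, by omega⟩
    rw [theta_pow]
    refine Submodule.smul_mem _ _ (Submodule.sub_mem _ ?_ ?_)
    · exact Submodule.subset_span ⟨_, by omega, rfl⟩
    · exact Submodule.subset_span ⟨_, by omega, rfl⟩
  | zero => simp
  | add x y _ _ hx hy => rw [map_add]; exact Submodule.add_mem _ hx hy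
  | smul a x _ hx => rw [map_smul]; exact Submodule.smul_mem _ _ hx

lemma P_mem (e : ℕ) : P e ∈ W 1 := by
  induction e with
  | zero => exact Submodule.subset_span ⟨1, le_rfl, by ext; simp [P]⟩
  | succ e ih =>
    have : P (e + 1) = theta (P e) := by ext k; simp [P, theta, pow_succ]; ring
    rw [this]; exact theta_mem ih

lemma prod_P_mem {ι : Type*} (S : Finset ι) (e : ι → ℕ) : ∏ i ∈ S, P (e i) ∈ W S.card := by
  classical
  induction S using Finset.induction_on with
  | empty => exact Submodule.subset_span ⟨0, le_rfl, by simp⟩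
  | insert a S ha ih =>
    rw [Finset.prod_insert ha, Finset.card_insert_of_notMem ha, add_comm]
    exact W_mul (P_mem _) ih

lemma W_poly {d h : ℕ} (hh : h ≤ d) {g : PowerSeries ℝ} (hg : g ∈ W d) :
    ∃ p : Polynomial ℝ, ∀ N : ℕ, 0 < N →
      (if h ≤ N then PowerSeries.coeff (N - h) g else 0) = p.eval (N : ℝ) := by
  induction hg using Submodule.span_induction with
  | mem x hx =>
    obtain ⟨j, hj, rfl⟩ := hx
    rcases j with _ | j
    · refine ⟨0, fun N hN => ?_⟩
      have : h = 0 := by omega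
      subst this
      simp [PowerSeries.coeff_one, hN.ne']
    · refine ⟨Polynomial.C ((j.factorial : ℝ)⁻¹) *
        (descPochhammer ℝ j).comp (Polynomial.X + Polynomial.C ((j : ℝ) - h)), fun N hN => ?_⟩
      have e1 : (N : ℝ) + ((j : ℝ) - h) = ((N + j - h : ℕ) : ℝ) := by
        rw [Nat.cast_sub (by omega)]; push_cast; ring
      have e2 : (if h ≤ N then PowerSeries.coeff (N - h) ((PowerSeries.mk 1 : PowerSeries ℝ) ^ (j+1))
          else 0) = ((N + j - h).choose j : ℕ) := by
        split_ifs with hN'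
        · rw [PowerSeries.mk_one_pow_eq_mk_choose_add, PowerSeries.coeff_mk]
          congr 2; omega
        · rw [Nat.choose_eq_zero_of_lt (by omega)]; simp
      rw [e2]
      simp only [Polynomial.eval_mul, Polynomial.eval_C, Polynomial.eval_comp, Polynomial.eval_add,
        Polynomial.eval_X, e1, descPochhammer_eval_eq_descFactorial]
      rw [Nat.descFactorial_eq_factorial_mul_choose]
      push_cast
      rw [inv_mul_cancel_left₀ (by positivity)]
  | zero => exact ⟨0, by simp⟩
  | add x y _ _ hx hy =>
    obtain ⟨p, hp⟩ := hx
    obtain ⟨q, hq⟩ := hy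
    refine ⟨p + q, fun N hN => ?_⟩
    rw [Polynomial.eval_add, ← hp N hN, ← hq N hN]
    split_ifs <;> simp
  | smul a x _ hx =>
    obtain ⟨p, hp⟩ := hx
    refine ⟨a • p, fun N hN => ?_⟩
    rw [Polynomial.eval_smul, ← hp N hN]
    split_ifs <;> simp

lemma sum_poly {ι : Type*} [Fintype ι] [DecidableEq ι] (S : Finset ι) {h : ℕ} (hh : h ≤ S.card)
    (g : MvPolynomial ι ℝ) :
    ∃ p : Polynomial ℝ, ∀ N : ℕ, 0 < N →
      (∑ k ∈ (if h ≤ N then Finset.finsuppAntidiag S (N - h) else ∅ : Finset (ι →₀ ℕ)),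
        MvPolynomial.eval (fun i => (k i : ℝ)) g) = p.eval (N : ℝ) := by
  induction g using MvPolynomial.induction_on' with
  | monomial e a =>
    obtain ⟨p, hp⟩ := W_poly hh (prod_P_mem S e)
    refine ⟨(a * ∏ i ∈ Sᶜ, (0 : ℝ) ^ e i) • p, fun N hN => ?_⟩
    rw [Polynomial.eval_smul, ← hp N hN]
    split_ifs with hN'
    · rw [PowerSeries.coeff_prod, smul_eq_mul, Finset.mul_sum]
      refine Finset.sum_congr rfl fun k hk => ?_
      rw [Finset.mem_finsuppAntidiag] at hk
      rw [MvPolynomial.eval_monomial, Finsupp.prod_fintype _ _ (by simp),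
        ← Finset.prod_compl_mul_prod S, mul_assoc]
      congr 2
      · refine Finset.prod_congr rfl fun i hi => ?_
        have : k i = 0 := by
          by_contra h
          exact (Finset.mem_compl.1 hi) (hk.2 (Finsupp.mem_support_iff.2 h))
        simp [this]
      · simp [P]
    · simp
  | add p q hp hq =>
    obtain ⟨p', hp⟩ := hp
    obtain ⟨q', hq⟩ := hq
    refine ⟨p' + q', fun N hN => ?_⟩
    rw [Polynomial.eval_add, ← hp N hN, ← hq N hN, ← Finset.sum_add_distrib]
    simp

/-! ### Part 2: lexicographic minimisation -/

/-- `c` is lexicographically nonnegative along the list -/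
def LexNN {ι : Type*} (c : ι → ℝ) : List ι → Prop
  | [] => True
  | i :: l => 0 < c i ∨ (c i = 0 ∧ LexNN c l)

lemma LexNN.of_smul {ι : Type*} {c : ι → ℝ} {ε : ℝ} (hε : 0 < ε) :
    ∀ l : List ι, LexNN (fun i => ε * c i) l → LexNN c l
  | [], _ => trivial
  | i :: l, h => by
    rcases h with h | ⟨h, h'⟩
    · exact Or.inl (by simpa [hε] using h)
    · exact Or.inr ⟨by simpa [hε.ne'] using h, LexNN.of_smul hε l h'⟩

lemma LexNN.antisymm {ι : Type*} {c : ι → ℝ} :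
    ∀ l : List ι, LexNN c l → LexNN (fun i => - c i) l → ∀ i ∈ l, c i = 0
  | [], _, _ => by simp
  | i :: l, h, h' => by
    have : c i = 0 ∧ LexNN c l ∧ LexNN (fun i => - c i) l := by
      rcases h with h | ⟨h, h1⟩ <;> rcases h' with h' | ⟨h', h1'⟩
      · linarith
      · linarith
      · linarith
      · exact ⟨h, h1, h1'⟩
    intro j hj
    rcases List.mem_cons.1 hj with rfl | hj
    · exact this.1
    · exact LexNN.antisymm l this.2.1 this.2.2 j hj

lemma exists_lexmin {ι : Type*} :
    ∀ (l : List ι) (K : Set (ι → ℝ)), IsCompact K → K.Nonempty →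
      ∃ a ∈ K, ∀ b ∈ K, LexNN (fun i => b i - a i) l
  | [], K, _, ⟨a, ha⟩ => ⟨a, ha, fun _ _ => trivial⟩
  | i :: l, K, hK, hne => by
    obtain ⟨a, ha, hmin⟩ := hK.exists_isMinOn hne (continuous_apply i).continuousOn
    obtain ⟨b, hb, hbmin⟩ := exists_lexmin l (K ∩ {b | b i = a i})
      (hK.inter_right (isClosed_eq (continuous_apply i) continuous_const)) ⟨a, ha, rfl⟩
    refine ⟨b, hb.1, fun c hc => ?_⟩
    have h1 : a i ≤ c i := hmin hc
    have h2 : b i = a i := hb.2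
    rcases h1.lt_or_eq with h | h
    · left; simpa [h2] using h
    · right; exact ⟨by simp [h2, h], hbmin c ⟨hc, h.symm⟩⟩

variable {ι : Type*} [Fintype ι] {n : ℕ}

/-- Good vectors: those which are lexicographically minimal in their fibre (depends only on
the support). -/
def Good (v : ι → Fin n → ℤ) (a : ι → ℝ) : Prop :=
  ∀ c : ι → ℝ, ∑ i, c i = 0 → (∀ j, ∑ i, c i * v i j = 0) → (∀ i, a i = 0 → 0 ≤ c i) →
    LexNN c Finset.univ.toList

lemma Good.congr {v : ι → Fin n → ℤ} {a b : ι → ℝ} (h : Good v a) (hab : ∀ i, a i = 0 → b i = 0) :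
    Good v b := fun c h1 h2 h3 => h c h1 h2 fun i hi => h3 i (hab i hi)

lemma Good.inj {v : ι → Fin n → ℤ} {a b : ι → ℝ} (ha : Good v a) (hb : Good v b)
    (ha0 : ∀ i, 0 ≤ a i) (hb0 : ∀ i, 0 ≤ b i) (hs : ∑ i, a i = ∑ i, b i)
    (hv : ∀ j, ∑ i, a i * v i j = ∑ i, b i * v i j) : a = b := by
  have h1 := ha (fun i => b i - a i) (by simp [hs]) (by simp [sub_mul, hv])
    (fun i hi => by simpa [hi] using hb0 i)
  have h2 := hb (fun i => a i - b i) (by simp [hs]) (by simp [sub_mul, hv])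
    (fun i hi => by simpa [hi] using ha0 i)
  funext i
  have := LexNN.antisymm _ h1 (by simpa using h2) i (by simp)
  linarith

lemma exists_good (v : ι → Fin n → ℤ) (a : ι → ℝ) (ha : ∀ i, 0 ≤ a i) :
    ∃ b, Good v b ∧ (∀ i, 0 ≤ b i) ∧ ∑ i, b i = ∑ i, a i ∧
      ∀ j, ∑ i, b i * v i j = ∑ i, a i * v i j := by
  set K : Set (ι → ℝ) := {b | (∀ i, 0 ≤ b i) ∧ ∑ i, b i = ∑ i, a i ∧
      ∀ j, ∑ i, b i * v i j = ∑ i, a i * v i j} with hKdef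
  have hcl : IsClosed K := by
    have : K = (⋂ i, {b | 0 ≤ b i}) ∩ ({b | ∑ i, b i = ∑ i, a i} ∩
        ⋂ j, {b : ι → ℝ | ∑ i, b i * v i j = ∑ i, a i * v i j}) := by
      ext b; simp [hKdef]
    rw [this]
    refine IsClosed.inter ?_ (IsClosed.inter ?_ ?_)
    · exact isClosed_iInter fun i => isClosed_le continuous_const (continuous_apply i)
    · exact isClosed_eq (by fun_prop) continuous_const
    · exact isClosed_iInter fun i => isClosed_eq (by fun_prop) continuous_const
  have hsub : K ⊆ Set.Icc 0 (fun _ => ∑ i, a i) := by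
    intro b hb
    refine ⟨hb.1, fun i => ?_⟩
    rw [← hb.2.1]
    exact Finset.single_le_sum (f := b) (fun i _ => hb.1 i) (Finset.mem_univ i)
  have hK : IsCompact K := isCompact_Icc.of_isClosed_subset hcl hsub
  obtain ⟨b, hb, hmin⟩ := exists_lexmin Finset.univ.toList K hK ⟨a, ha, rfl, fun _ => rfl⟩
  refine ⟨b, ?_, hb⟩
  intro c hc1 hc2 hc3
  -- a small step
  have hε : ∃ ε : ℝ, 0 < ε ∧ ∀ i, 0 ≤ b i + ε * c i := by
    have : ∀ i, ∀ᶠ ε : ℝ in nhdsWithin 0 (Set.Ioi 0), 0 ≤ b i + ε * c i := by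
      intro i
      rcases (hb.1 i).lt_or_eq with h | h
      · have : Filter.Tendsto (fun ε : ℝ => b i + ε * c i) (nhdsWithin 0 (Set.Ioi 0))
            (nhds (b i + 0 * c i)) :=
          (Continuous.tendsto (by fun_prop) 0).mono_left nhdsWithin_le_nhds
        have := this.eventually (lt_mem_nhds (a := 0) (by simpa using h))
        exact this.mono fun _ h => h.le
      · filter_upwards [self_mem_nhdsWithin] with ε hε
        rw [← h, zero_add]
        exact mul_nonneg (le_of_lt hε) (hc3 i h.symm)
    obtain ⟨ε, h1, h2⟩ := ((Filter.eventually_all.2 this).and self_mem_nhdsWithin).exists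
    exact ⟨ε, h2, h1⟩
  obtain ⟨ε, hε, hε'⟩ := hε
  have := hmin (fun i => b i + ε * c i) ⟨hε', ?_, fun j => ?_⟩
  · exact LexNN.of_smul hε _ (by simpa using this)
  · rw [Finset.sum_add_distrib, ← Finset.mul_sum, hc1, hb.2.1]; simp
  · simp only [add_mul, mul_assoc]
    rw [Finset.sum_add_distrib, ← Finset.mul_sum, hc2, hb.2.2]; simp

/-- The finite set of remainders. -/
def J (v : ι → Fin n → ℤ) : Set (ι → ℝ) :=
  {r | Good v r ∧ (∀ i, 0 ≤ r i) ∧ (∀ i, r i ≤ 1) ∧ (∃ h : ℕ, ∑ i, r i = h) ∧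
    ∀ j, ∃ z : ℤ, ∑ i, r i * v i j = z}

lemma J_finite (v : ι → Fin n → ℤ) : (J v).Finite := by
  refine Set.Finite.of_injOn (f := fun r : ι → ℝ => ((⌊∑ i, r i⌋, fun j => ⌊∑ i, r i * v i j⌋) :
    ℤ × (Fin n → ℤ))) (t := Set.Icc 0 (Fintype.card ι : ℤ) ×ˢ
      Set.Icc (fun j => - ∑ i, |v i j|) (fun j => ∑ i, |v i j|)) ?_ ?_ ?_
  · rintro r ⟨-, h0, h1, ⟨h, hh⟩, hz⟩
    refine ⟨⟨?_, ?_⟩, fun j => ?_, fun j => ?_⟩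
    · simp [hh]
    · have : ∑ i, r i ≤ ∑ i : ι, (1 : ℝ) := Finset.sum_le_sum fun i _ => h1 i
      rw [hh] at this
      simp only [hh, Int.floor_natCast]
      simp only [Finset.sum_const, Finset.card_univ, nsmul_eq_mul, mul_one] at this
      exact_mod_cast this
    all_goals
      obtain ⟨z, hz⟩ := hz j
      have : |∑ i, r i * v i j| ≤ ∑ i, |(v i j : ℝ)| := by
        refine (Finset.abs_sum_le_sum_abs _ _).trans (Finset.sum_le_sum fun i _ => ?_)
        rw [abs_mul, abs_of_nonneg (h0 i)]
        exact mul_le_of_le_one_left (abs_nonneg _) (h1 i)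
      rw [hz] at this
      have := abs_le.1 this
      simp only [hz, Int.floor_intCast]
    · exact_mod_cast this.1
    · exact_mod_cast this.2
  · rintro r ⟨hg, h0, h1, ⟨h, hh⟩, hz⟩ r' ⟨hg', h0', h1', ⟨h', hh'⟩, hz'⟩ e
    simp only [Prod.mk.injEq] at e
    refine hg.inj hg' h0 h0' ?_ fun j => ?_
    · have := e.1
      rw [hh, hh'] at this ⊢
      simpa using this
    · have := congrFun e.2 j
      obtain ⟨z, hz⟩ := hz j
      obtain ⟨z', hz'⟩ := hz' j
      simp only [hz, hz', Int.floor_intCast] at this ⊢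
      rw [this]
  · exact (Set.finite_Icc _ _).prod (Set.finite_Icc _ _)

lemma mem_smul_hull (v : ι → Fin n → ℤ) (N : ℕ) (hN : 0 < N) (x : Fin n → ℝ) :
    x ∈ (N : ℝ) • convexHull ℝ (Set.range fun i j => (v i j : ℝ)) ↔
      ∃ a : ι → ℝ, (∀ i, 0 ≤ a i) ∧ ∑ i, a i = N ∧ ∀ j, ∑ i, a i * v i j = x j := by
  have hN' : (0 : ℝ) < N := by exact_mod_cast hN
  constructor
  · rintro ⟨y, hy, rfl⟩
    have : ∃ a : ι → ℝ, (∀ i, 0 ≤ a i) ∧ ∑ i, a i = 1 ∧ ∀ j, ∑ i, a i * v i j = y j := by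
      let C : Set (Fin n → ℝ) := {y | ∃ a : ι → ℝ, (∀ i, 0 ≤ a i) ∧ ∑ i, a i = 1 ∧
        ∀ j, ∑ i, a i * v i j = y j}
      suffices convexHull ℝ (Set.range fun i j => (v i j : ℝ)) ⊆ C from this hy
      refine convexHull_min ?_ ?_
      · classical
        rintro _ ⟨i, rfl⟩
        refine ⟨Pi.single i 1, fun k => ?_, by simp, fun j => ?_⟩
        · by_cases h : k = i
          · subst h; simp
          · simp [h]
        · simp [Pi.single_apply]
      · rintro x ⟨a, ha0, ha1, hax⟩ y ⟨b, hb0, hb1, hby⟩ s t hs ht hst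
        refine ⟨fun i => s * a i + t * b i, fun i => ?_, ?_, fun j => ?_⟩
        · have := ha0 i; have := hb0 i; positivity
        · simp [Finset.sum_add_distrib, ← Finset.mul_sum, ha1, hb1, hst]
        · simp [add_mul, mul_assoc, Finset.sum_add_distrib, ← Finset.mul_sum, hax, hby]
    obtain ⟨a, h0, h1, h2⟩ := this
    refine ⟨fun i => N * a i, fun i => ?_, ?_, fun j => ?_⟩
    · have := h0 i; positivity
    · simp [← Finset.mul_sum, h1]
    · simp [mul_assoc, ← Finset.mul_sum, h2]
  · rintro ⟨a, h0, h1, h2⟩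
    refine ⟨fun j => (N : ℝ)⁻¹ * x j, ?_, ?_⟩
    · refine mem_convexHull_of_exists_fintype (fun i => (N : ℝ)⁻¹ * a i)
        (fun i j => (v i j : ℝ)) (fun i => ?_) ?_ (fun i => ⟨i, rfl⟩) ?_
      · have := h0 i; positivity
      · rw [← Finset.mul_sum, h1, inv_mul_cancel₀ hN'.ne']
      · funext j
        simp [← h2, Finset.mul_sum, mul_assoc]
    · funext j
      simp [hN'.ne']

/-- height of a remainder -/
noncomputable def ht (r : ι → ℝ) : ℕ := ⌊∑ i, r i⌋₊

/-- support as a finset -/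
noncomputable def supp (r : ι → ℝ) : Finset ι := by
  classical exact Finset.univ.filter fun i => r i ≠ 0

lemma mem_supp {r : ι → ℝ} {i : ι} : i ∈ supp r ↔ r i ≠ 0 := by simp [supp]

open Classical in
/-- admissible integral parts -/
noncomputable def ks (N : ℕ) (r : ι → ℝ) : Finset (ι →₀ ℕ) :=
  if ht r ≤ N then Finset.finsuppAntidiag (supp r) (N - ht r) else ∅

lemma mem_ks {N : ℕ} {r : ι → ℝ} {h : ℕ} (hr : ∑ i, r i = h) {k : ι →₀ ℕ} :
    k ∈ ks N r ↔ (∑ i, (r i + k i) = N ∧ ∀ i, r i = 0 → k i = 0) := by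
  classical
  have hht : ht r = h := by simp [ht, hr]
  have hsum : (∀ i, r i = 0 → k i = 0) → ∑ i ∈ supp r, k i = ∑ i, k i := by
    intro h
    refine Finset.sum_subset (Finset.subset_univ _) fun i _ hi => h i ?_
    by_contra h'
    exact hi (mem_supp.2 h')
  have hsub : k.support ⊆ supp r ↔ ∀ i, r i = 0 → k i = 0 := by
    simp only [Finset.subset_iff, mem_supp, Finsupp.mem_support_iff]
    exact forall_congr' fun i => not_imp_not
  have hreal : (∑ i, (r i + k i) = N) ↔ h + ∑ i, k i = N := by
    rw [Finset.sum_add_distrib, hr]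
    exact_mod_cast Iff.rfl
  rw [ks, hht, hreal, ← hsub]
  split_ifs with hN
  · rw [Finset.mem_finsuppAntidiag]
    refine and_congr_left fun hs => ?_
    rw [hsum (hsub.1 hs)]
    omega
  · simp only [Finset.notMem_empty, false_iff, not_and]
    intro h; omega

/-- the point of `ℝⁿ` attached to a pair -/
noncomputable def pt (v : ι → Fin n → ℤ) (q : (_ : ι → ℝ) × (ι →₀ ℕ)) : Fin n → ℝ :=
  fun j => ∑ i, (q.1 i + q.2 i) * v i j

lemma recover {r r' : ℝ} {k k' : ℕ} (h0 : 0 ≤ r) (h1 : r ≤ 1) (h0' : 0 ≤ r') (h1' : r' ≤ 1)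
    (hk : r = 0 → k = 0) (hk' : r' = 0 → k' = 0) (h : r + k = r' + k') : k = k' := by
  have key : ∀ {r : ℝ} {k : ℕ}, 0 ≤ r → r ≤ 1 → (r = 0 → k = 0) → k = ⌈r + k⌉₊ - 1 := by
    intro r k h0 h1 hk
    rcases h0.eq_or_lt with h | h
    · simp [hk h.symm, ← h]
    · rw [Nat.ceil_add_natCast h0, (Nat.ceil_eq_iff one_ne_zero).2 ⟨by simpa using h, by simpa using h1⟩]
      omega
  rw [key h0 h1 hk, key h0' h1' hk', h]

lemma bij (v : ι → Fin n → ℤ) (N : ℕ) (hN : 0 < N) :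
    Set.BijOn (pt v) ((J_finite v).toFinset.sigma (ks N) : Finset ((_ : ι → ℝ) × (ι →₀ ℕ)))
      {x | x ∈ (N : ℝ) • convexHull ℝ (Set.range fun i j => (v i j : ℝ)) ∧
        ∀ j, ∃ z : ℤ, x j = z} := by
  have hgood : ∀ (r : ι → ℝ) (k : ι →₀ ℕ), (∀ i, 0 ≤ r i) →
      ∀ i, r i + k i = 0 → r i = 0 := by
    intro r k h0 i hi
    have := h0 i
    have : (0 : ℝ) ≤ k i := by positivity
    linarith
  refine ⟨?_, ?_, ?_⟩
  · rintro ⟨r, k⟩ hq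
    simp only [Finset.mem_coe, Finset.mem_sigma, Set.Finite.mem_toFinset] at hq
    obtain ⟨⟨hg, h0, h1, ⟨h, hh⟩, hz⟩, hk⟩ := hq
    rw [mem_ks hh] at hk
    refine ⟨(mem_smul_hull v N hN _).2 ⟨fun i => r i + k i, fun i => ?_, hk.1, fun j => rfl⟩,
      fun j => ?_⟩
    · have := h0 i; positivity
    · obtain ⟨z, hz⟩ := hz j
      refine ⟨z + ∑ i, k i * v i j, ?_⟩
      simp only [pt, add_mul, Finset.sum_add_distrib, hz]
      push_cast; rfl
  · rintro ⟨r, k⟩ hq ⟨r', k'⟩ hq' e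
    simp only [Finset.mem_coe, Finset.mem_sigma, Set.Finite.mem_toFinset] at hq hq'
    obtain ⟨⟨hg, h0, h1, ⟨h, hh⟩, hz⟩, hk⟩ := hq
    obtain ⟨⟨hg', h0', h1', ⟨h', hh'⟩, hz'⟩, hk'⟩ := hq'
    rw [mem_ks hh] at hk
    rw [mem_ks hh'] at hk'
    have hG : Good v (fun i => r i + k i) := hg.congr fun i hi => by simp [hi, hk.2 i hi]
    have hG' : Good v (fun i => r' i + k' i) := hg'.congr fun i hi => by simp [hi, hk'.2 i hi]
    have hab := hG.inj hG' (fun i => by have := h0 i; positivity)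
      (fun i => by have := h0' i; positivity) (hk.1.trans hk'.1.symm) (fun j => congrFun e j)
    have hkk : k = k' := by
      ext i
      exact recover (h0 i) (h1 i) (h0' i) (h1' i) (hk.2 i) (hk'.2 i) (congrFun hab i)
    subst hkk
    have : r = r' := by
      funext i
      simpa using congrFun hab i
    subst this
    rfl
  · rintro x ⟨hx, hxz⟩
    obtain ⟨a, ha0, ha1, hax⟩ := (mem_smul_hull v N hN x).1 hx
    obtain ⟨b, hb, hb0, hb1, hbx⟩ := exists_good v a ha0
    let k : ι →₀ ℕ := Finsupp.equivFunOnFinite.symm fun i => ⌈b i⌉₊ - 1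
    have hkdef : ∀ i, k i = ⌈b i⌉₊ - 1 := fun i => rfl
    let r : ι → ℝ := fun i => b i - k i
    have hrk : ∀ i, r i + k i = b i := fun i => by simp [r]
    have hpos : ∀ i, 0 < b i → 0 < r i ∧ r i ≤ 1 := by
      intro i hi
      have h1 : 0 < ⌈b i⌉₊ := Nat.ceil_pos.2 hi
      have h2 : ((k i : ℕ) : ℝ) = ⌈b i⌉₊ - 1 := by
        rw [hkdef, Nat.cast_sub h1]; simp
      have h3 := Nat.ceil_lt_add_one hi.le
      have h4 := Nat.le_ceil (b i)
      simp only [r, h2]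
      constructor <;> linarith
    have hzero : ∀ i, b i = 0 → k i = 0 ∧ r i = 0 := by
      intro i hi
      have : k i = 0 := by simp [hkdef, hi]
      exact ⟨this, by simp [r, this, hi]⟩
    have hr : ∀ i, 0 ≤ r i ∧ r i ≤ 1 ∧ (r i = 0 → b i = 0) := by
      intro i
      rcases (hb0 i).eq_or_lt with h | h
      · simp [(hzero i h.symm).2, ← h]
      · exact ⟨(hpos i h).1.le, (hpos i h).2, fun h' => absurd h' (hpos i h).1.ne'⟩
    have hht : ∃ h : ℕ, ∑ i, r i = h := by
      have h1 : ∑ i, r i = ((N - ∑ i, k i : ℤ) : ℝ) := by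
        push_cast
        rw [← ha1, ← hb1, ← Finset.sum_sub_distrib]
      have h2 : 0 ≤ ∑ i, r i := Finset.sum_nonneg fun i _ => (hr i).1
      rw [h1] at h2
      obtain ⟨h, hh⟩ := Int.eq_ofNat_of_zero_le (Int.cast_nonneg_iff.1 h2)
      exact ⟨h, by rw [h1, hh]; simp⟩
    obtain ⟨h, hh⟩ := hht
    refine ⟨⟨r, k⟩, ?_, ?_⟩
    · simp only [Finset.mem_coe, Finset.mem_sigma, Set.Finite.mem_toFinset]
      refine ⟨⟨hb.congr fun i hi => (hzero i hi).2, fun i => (hr i).1, fun i => (hr i).2.1,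
        ⟨h, hh⟩, fun j => ?_⟩, (mem_ks hh).2 ⟨?_, fun i hi => (hzero i ((hr i).2.2 hi)).1⟩⟩
      · obtain ⟨z, hz⟩ := hxz j
        refine ⟨z - ∑ i, k i * v i j, ?_⟩
        push_cast
        rw [← hz, ← hax, ← hbx, ← Finset.sum_sub_distrib]
        simp [r, sub_mul]
      · simp only [hrk, hb1, ha1]
    · funext j
      simp only [pt, hrk, hbx, hax]

lemma ht_le {r : ι → ℝ} (h1 : ∀ i, r i ≤ 1) : ht r ≤ (supp r).card := by
  have : ∑ i, r i ≤ (supp r).card := by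
    have e : ∑ i ∈ supp r, r i = ∑ i, r i := by
      refine Finset.sum_subset (Finset.subset_univ _) fun i _ hi => ?_
      by_contra h'
      exact hi (mem_supp.2 h')
    rw [← e]
    simpa using Finset.sum_le_card_nsmul (supp r) r 1 fun i _ => h1 i
  exact Nat.floor_le_of_le this

theorem main (v : ι → Fin n → ℤ) (f : MvPolynomial (Fin n) ℝ) :
    ∃ p : Polynomial ℝ, ∀ N : ℕ, 0 < N →
      (∑ᶠ ℓ ∈ {ℓ : Fin n → ℤ | (fun i => (ℓ i : ℝ)) ∈
          (N : ℝ) • convexHull ℝ (Set.range fun i j => (v i j : ℝ))},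
        MvPolynomial.eval (fun i => (ℓ i : ℝ)) f) = p.eval (N : ℝ) := by
  classical
  have hloc : ∀ r ∈ (J_finite v).toFinset, ∃ p : Polynomial ℝ, ∀ N : ℕ, 0 < N →
      ∑ k ∈ ks N r, MvPolynomial.eval (pt v ⟨r, k⟩) f = p.eval (N : ℝ) := by
    intro r hr
    rw [Set.Finite.mem_toFinset] at hr
    obtain ⟨p, hp⟩ := sum_poly (supp r) (ht_le hr.2.2.1)
      (MvPolynomial.bind₁ (fun j => ∑ i, (MvPolynomial.C (r i) + MvPolynomial.X i) *
        MvPolynomial.C (v i j : ℝ)) f)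
    refine ⟨p, fun N hN => ?_⟩
    rw [← hp N hN, ks]
    refine Finset.sum_congr (by congr) fun k _ => ?_
    rw [MvPolynomial.eval, MvPolynomial.eval, MvPolynomial.eval₂Hom_bind₁]
    congr 2
    funext j
    simp [pt]
  choose! p hp using hloc
  refine ⟨∑ r ∈ (J_finite v).toFinset, p r, fun N hN => ?_⟩
  have hcast : Set.BijOn (fun (ℓ : Fin n → ℤ) j => (ℓ j : ℝ))
      {ℓ : Fin n → ℤ | (fun i => (ℓ i : ℝ)) ∈
          (N : ℝ) • convexHull ℝ (Set.range fun i j => (v i j : ℝ))}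
      {x | x ∈ (N : ℝ) • convexHull ℝ (Set.range fun i j => (v i j : ℝ)) ∧
        ∀ j, ∃ z : ℤ, x j = z} := by
    refine ⟨fun ℓ hℓ => ⟨hℓ, fun j => ⟨ℓ j, rfl⟩⟩, fun ℓ _ ℓ' _ e => ?_, fun x hx => ?_⟩
    · funext j
      have := congrFun e j
      exact Int.cast_injective this
    · choose z hz using hx.2
      have : (fun j => (z j : ℝ)) = x := funext fun j => (hz j).symm
      exact ⟨z, by simpa [this] using hx.1, this⟩
  rw [finsum_mem_eq_of_bijOn _ hcast (g := fun x => MvPolynomial.eval x f) (fun _ _ => rfl),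
    ← finsum_mem_eq_of_bijOn _ (bij v N hN) (f := fun q => MvPolynomial.eval (pt v q) f)
      (fun _ _ => rfl), finsum_mem_coe_finset, Finset.sum_sigma, Polynomial.eval_finsetSum]
  exact Finset.sum_congr rfl fun r hr => hp r hr N hN

end Ehr

/-- For a convex lattice polytope `Δ ⊂ ℝⁿ` and a polynomial `f`,
the sum `p(N,f) = Σ_{ℓ ∈ (N·Δ)∩ℤⁿ} f(ℓ)` is a polynomial in the positive integer `N`. -/
theorem stmt_5 (n : ℕ) (V : Finset (Fin n → ℤ)) (Δ : Set (Fin n → ℝ))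
    (hΔ : Δ = convexHull ℝ ((fun (v : Fin n → ℤ) (i : Fin n) => (v i : ℝ)) '' ↑V))
    (f : MvPolynomial (Fin n) ℝ) :
    ∃ p : Polynomial ℝ,
      ∀ N : ℕ, 0 < N →
        (∑ᶠ ℓ ∈ {ℓ : Fin n → ℤ | (fun i => (ℓ i : ℝ)) ∈ (N : ℝ) • Δ},
            MvPolynomial.eval (fun i => (ℓ i : ℝ)) f)
          = p.eval (N : ℝ) := by
  subst hΔ
  rw [Set.image_eq_range]
  exact Ehr.main (fun i : ↥V => (i : Fin n → ℤ)) f
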